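/- arXiv:1204.5357 — 2 statements merged into one kernel-verified Lean document; each statement's English description precedes it below -/
import Mathlib

section
/- Let G be a chain graph over a finite vertex set V and let A, B be distinct nodes. Then A and B are adjacent in G if and only if there is no S ⊆ V ∖ {A, B} such that A ⊥_G B | S. -/
/-- There is an edge between `a` and `b`: a directed edge `a → b`, a directed edge
`b → a`, or an undirected edge `a − b`. -/
def Adj (dir und : V → V → Prop) (a b : V) : Prop :=
  dir a b ∨ dir b a ∨ und a b ∨ und b a

/-- A hybrid graph: undirected edges are symmetric, there are no self loops, and there
is at most one edge between any pair of distinct nodes. -/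
def IsHybrid (dir und : V → V → Prop) : Prop :=
  (∀ a b, und a b → und b a) ∧
  (∀ a b, dir a b → a ≠ b) ∧
  (∀ a b, und a b → a ≠ b) ∧
  (∀ a b, dir a b → ¬ dir b a) ∧
  (∀ a b, dir a b → ¬ und a b ∧ ¬ und b a)

/-- Every pair of consecutive elements of the list `l` is related by `R`. -/
def ChainRel (R : V → V → Prop) (l : List V) : Prop :=
  ∀ (i : ℕ) (a b : V), l[i]? = some a → l[i + 1]? = some b → R a b

/-- The list `l` is a route in the graph, i.e. consecutive nodes are adjacent
(and `l` is nonempty). -/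
def IsRoute (dir und : V → V → Prop) (l : List V) : Prop :=
  l ≠ [] ∧ ChainRel (Adj dir und) l

/-- The list `l` is a descending route: every step is `a → b` or `a − b`. -/
def IsDescRouteList (dir und : V → V → Prop) (l : List V) : Prop :=
  l ≠ [] ∧ ChainRel (fun a b => dir a b ∨ und a b) l

/-- There is a descending route from `a` to `b`. -/
def DescRoute (dir und : V → V → Prop) (a b : V) : Prop :=
  ∃ l : List V, l.head? = some a ∧ l.getLast? = some b ∧
    ChainRel (fun x y => dir x y ∨ und x y) l

/-- The list `l` is a semidirected cycle. -/
def SemidirectedCycle (dir und : V → V → Prop) (l : List V) : Prop :=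
  2 ≤ l.length ∧ l.head? = l.getLast? ∧
  ChainRel (fun a b => dir a b ∨ und a b) l ∧
  ∃ (i : ℕ) (a b : V), l[i]? = some a ∧ l[i + 1]? = some b ∧ dir a b

/-- A chain graph is a hybrid graph with no semidirected cycle. -/
def IsChainGraph (dir und : V → V → Prop) : Prop :=
  IsHybrid dir und ∧ ∀ l : List V, ¬ SemidirectedCycle dir und l

/-- The parents of the set of nodes `X`. -/
def pa (dir : V → V → Prop) (X : Set V) : Set V :=
  {v | v ∉ X ∧ ∃ w ∈ X, dir v w}

/-- The neighbors of the set of nodes `X`. -/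
def nbr (und : V → V → Prop) (X : Set V) : Set V :=
  {v | v ∉ X ∧ ∃ w ∈ X, und v w}

/-- The adjacents of the set of nodes `X`. -/
def adSet (dir und : V → V → Prop) (X : Set V) : Set V :=
  {v | v ∉ X ∧ ∃ w ∈ X, Adj dir und v w}

/-- The descendants of the set of nodes `X`. -/
def de (dir und : V → V → Prop) (X : Set V) : Set V :=
  {v | v ∉ X ∧ ∃ w ∈ X, DescRoute dir und w v}

/-- The connectivity component of the node `a`: all nodes reachable from `a` by a
route whose edges are all undirected. -/
def co (und : V → V → Prop) (a : V) : Set V :=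
  {b | Relation.ReflTransGen und a b}

/-- `b` is a head-no-tail node in the subroute `a, b, c`, i.e. the subroute is of
the form `a → b ← c`, `a → b − c` or `a − b ← c`. -/
def HeadNoTail (dir und : V → V → Prop) (a b c : V) : Prop :=
  (dir a b ∧ dir c b) ∨ (dir a b ∧ und b c) ∨ (und a b ∧ dir c b)

/-- The route `l` is `Z`-open: every head-no-tail (occurrence of a) node is in `Z`
and every other (occurrence of a) node is not in `Z`. -/
def ZOpen (dir und : V → V → Prop) (Z : Set V) (l : List V) : Prop :=
  ChainRel (Adj dir und) l ∧
  (∀ (i : ℕ) (a b c : V), l[i]? = some a → l[i + 1]? = some b → l[i + 2]? = some c →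
    (HeadNoTail dir und a b c ↔ b ∈ Z)) ∧
  (∀ a, l.head? = some a → a ∉ Z) ∧
  (∀ a, l.getLast? = some a → a ∉ Z)

/-- `X` is separated from `Y` given `Z`: there is no `Z`-open route between a node
of `X` and a node of `Y`. -/
def Separ (dir und : V → V → Prop) (X Y Z : Set V) : Prop :=
  ¬ ∃ (l : List V) (x y : V), x ∈ X ∧ y ∈ Y ∧ l.head? = some x ∧ l.getLast? = some y ∧
      ZOpen dir und Z l

/-- The graph has a triplex `({A,C},B)`: an induced subgraph of the form `A → B ← C`,
`A → B − C` or `A − B ← C`. -/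
def Triplex (dir und : V → V → Prop) (A B C : V) : Prop :=
  A ≠ C ∧ ¬ Adj dir und A C ∧
  ((dir A B ∧ dir C B) ∨ (dir A B ∧ und B C) ∨ (und A B ∧ dir C B))

/-- The graph has an immorality `A → B ← C`. -/
def Immorality (dir und : V → V → Prop) (A B C : V) : Prop :=
  A ≠ C ∧ ¬ Adj dir und A C ∧ dir A B ∧ dir C B

/-- The graph has a flag `A → B − C`. -/
def FlagIn (dir und : V → V → Prop) (A B C : V) : Prop :=
  A ≠ C ∧ ¬ Adj dir und A C ∧ dir A B ∧ und B C

theorem ChainRel.cons {V : Type} {R : V → V → Prop} {a b : V} {l : List V}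
    (hl : ChainRel R l) (hb : l.head? = some b) (h : R a b) : ChainRel R (a :: l) := by
  intro i x y hx hy
  cases i with
  | zero =>
    rw [List.head?_eq_getElem?] at hb
    simp_all
  | succ i => exact hl i x y (by simpa using hx) (by simpa using hy)

theorem exists_chainRel_of_reflTransGen {V : Type} {R : V → V → Prop} {a b : V}
    (h : Relation.ReflTransGen R a b) :
    ∃ l : List V, l.head? = some a ∧ l.getLast? = some b ∧ ChainRel R l := by
  induction h using Relation.ReflTransGen.head_induction_on with
  | refl => exact ⟨[b], rfl, rfl, by intro i x y _ hy; simp at hy⟩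
  | @head a c hac _ ih =>
    obtain ⟨l, hc, hb, hl⟩ := ih
    exact ⟨a :: l, rfl, by simp [List.getLast?_cons, hb], hl.cons hc hac⟩

/-- Reachability by a descending route. -/
def Reach {V : Type} (dir und : V → V → Prop) : V → V → Prop :=
  Relation.ReflTransGen fun a b => dir a b ∨ und a b

theorem IsChainGraph.not_reach {V : Type} {dir und : V → V → Prop}
    (hG : IsChainGraph dir und) {a b : V} (h : dir a b) : ¬ Reach dir und b a := by
  intro hr
  obtain ⟨l, hb, ha, hl⟩ := exists_chainRel_of_reflTransGen hr
  have hne : l ≠ [] := by rintro rfl; simp at hb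
  refine hG.2 (a :: l) ⟨?_, ?_, hl.cons hb (Or.inl h), 0, a, b, by simp, ?_, h⟩
  · have := List.length_pos_iff.2 hne
    simp only [List.length_cons]; omega
  · simp [List.getLast?_cons, ha]
  · rw [List.head?_eq_getElem?] at hb
    simpa using hb

theorem HeadNoTail.symm {V : Type} {dir und : V → V → Prop}
    (hu : ∀ a b, und a b → und b a) {a b c : V} (h : HeadNoTail dir und a b c) :
    HeadNoTail dir und c b a := by
  rcases h with ⟨h, k⟩ | ⟨h, k⟩ | ⟨h, k⟩
  · exact Or.inl ⟨k, h⟩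
  · exact Or.inr (Or.inr ⟨hu _ _ k, h⟩)
  · exact Or.inr (Or.inl ⟨k, hu _ _ h⟩)

theorem Adj.symm {V : Type} {dir und : V → V → Prop} {a b : V} (h : Adj dir und a b) :
    Adj dir und b a := by
  unfold Adj at *; tauto

theorem ZOpen.reverse {V : Type} {dir und : V → V → Prop}
    (hu : ∀ a b, und a b → und b a) {Z : Set V} {l : List V} (h : ZOpen dir und Z l) :
    ZOpen dir und Z l.reverse := by
  obtain ⟨hc, hm, hh, ht⟩ := h
  have lt {i : ℕ} {a : V} (hi : l.reverse[i]? = some a) : i < l.length := by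
    obtain ⟨h, -⟩ := List.getElem?_eq_some_iff.1 hi
    simpa using h
  refine ⟨?_, ?_, by simpa using ht, by simpa using hh⟩
  · intro i a b ha hb
    have h1 := lt hb
    rw [List.getElem?_reverse (lt ha)] at ha
    rw [List.getElem?_reverse h1] at hb
    refine (hc _ b a hb ?_).symm
    rw [← ha]; congr 1; omega
  · intro i a b c ha hb hc'
    have h2 := lt hc'
    rw [List.getElem?_reverse (lt ha)] at ha
    rw [List.getElem?_reverse (lt hb)] at hb
    rw [List.getElem?_reverse h2] at hc'
    have key := hm (l.length - 1 - (i + 2)) c b a hc'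
      (by rw [← hb]; congr 1; omega) (by rw [← ha]; congr 1; omega)
    exact ⟨fun k => key.1 (k.symm hu), fun k => (key.2 k).symm hu⟩

theorem Separ.symm {V : Type} {dir und : V → V → Prop}
    (hu : ∀ a b, und a b → und b a) {X Y Z : Set V} (h : Separ dir und X Y Z) :
    Separ dir und Y X Z := by
  rintro ⟨l, y, x, hy, hx, hhead, hlast, hl⟩
  exact h ⟨l.reverse, x, y, hx, hy, by simpa using hlast, by simpa using hhead, hl.reverse hu⟩

/-- Once an open route takes a descending step into a set that is closed under descending
steps and contains no node of the conditioning set, it stays in that set. -/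
theorem ZOpen.getLast_of_forward {V : Type} {dir und : V → V → Prop}
    (hu : ∀ a b, und a b → und b a) {Z : Set V} {l : List V} (hl : ZOpen dir und Z l)
    {P : V → Prop} (hP : ∀ a b, P a → dir a b ∨ und a b → P b) (hZ : ∀ a ∈ Z, ¬ P a)
    {a b z : V} (ha : l[0]? = some a) (hb : l[1]? = some b)
    (hab : dir a b ∨ und a b) (hPb : P b) (hz : l.getLast? = some z) : P z := by
  have key : ∀ k x y, l[k]? = some x → l[k + 1]? = some y → (dir x y ∨ und x y) ∧ P y := by
    intro k
    induction k with
    | zero =>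
      intro x y hx hy
      obtain rfl : a = x := by simpa [ha] using hx
      obtain rfl : b = y := by simpa [hb] using hy
      exact ⟨hab, hPb⟩
    | succ k ih =>
      intro y z hy hz
      obtain ⟨hk, -⟩ := List.getElem?_eq_some_iff.1 hy
      have hx : l[k]? = some l[k] := List.getElem?_eq_getElem (by omega)
      obtain ⟨hxy, hPy⟩ := ih _ y hx hy
      have hyz : dir y z ∨ und y z := by
        rcases hl.1 _ y z hy hz with h | h | h | h
        · exact Or.inl h
        · refine absurd hPy (hZ y ((hl.2.1 k _ y z hx hy hz).1 ?_))
          rcases hxy with k | k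
          · exact Or.inl ⟨k, h⟩
          · exact Or.inr (Or.inr ⟨k, h⟩)
        · exact Or.inr h
        · exact Or.inr (hu _ _ h)
      exact ⟨hyz, hP _ _ hPy hyz⟩
  obtain ⟨h1, -⟩ := List.getElem?_eq_some_iff.1 hb
  rw [List.getLast?_eq_getElem?] at hz
  refine (key (l.length - 2) l[l.length - 2] z (List.getElem?_eq_getElem _) ?_).2
  rw [← hz]; congr 1; omega

theorem ZOpen.exists_next {V : Type} {dir und : V → V → Prop} {Z : Set V} {l : List V}
    (hl : ZOpen dir und Z l) {i : ℕ} {b : V} (hb : l[i]? = some b) (hbZ : b ∈ Z) :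
    ∃ c, l[i + 1]? = some c := by
  obtain ⟨h1, -⟩ := List.getElem?_eq_some_iff.1 hb
  by_cases h : i + 1 < l.length
  · exact ⟨_, List.getElem?_eq_getElem h⟩
  · refine absurd hbZ (hl.2.2.2 b ?_)
    rw [List.getLast?_eq_getElem?, ← hb]; congr 1; omega

/-- An open route cannot enter the conditioning set against a directed edge. -/
theorem ZOpen.not_mem_of_dir {V : Type} {dir und : V → V → Prop}
    (hH : IsHybrid dir und) {Z : Set V} {l : List V} (hl : ZOpen dir und Z l)
    {i : ℕ} {a b : V} (ha : l[i]? = some a) (hb : l[i + 1]? = some b) (hba : dir b a) :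
    b ∉ Z := by
  intro hbZ
  obtain ⟨c, hc⟩ := hl.exists_next hb hbZ
  have h1 := hH.2.2.2.1 b a hba
  have h2 := (hH.2.2.2.2 b a hba).2
  rcases (hl.2.1 i a b c ha hb hc).2 hbZ with h | h | h
  · exact h1 h.1
  · exact h1 h.1
  · exact h2 h.1

/-- A node is separated by its parents from every nonadjacent node that is not reachable
by a descending route. -/
theorem IsChainGraph.separ_of_not_reach {V : Type} {dir und : V → V → Prop}
    (hG : IsChainGraph dir und) {A B : V} (hAB : A ≠ B)
    (hr : ¬ Reach dir und A B) : Separ dir und {A} {B} {v | dir v A} := by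
  have hu := hG.1.1
  rintro ⟨l, x, y, rfl, rfl, hhead, hlast, hl⟩
  have h0 : l[0]? = some x := by rw [← List.head?_eq_getElem?, hhead]
  have hlen : 1 < l.length := by
    by_contra h
    rw [List.getLast?_eq_getElem?, show l.length - 1 = 0 by omega, h0] at hlast
    exact hAB (Option.some.inj hlast)
  obtain ⟨C, h1⟩ : ∃ C, l[1]? = some C := ⟨_, List.getElem?_eq_getElem hlen⟩
  have fwd (h : dir x C ∨ und x C) : False :=
    hr (hl.getLast_of_forward hu (P := Reach dir und x) (fun _ _ h k => h.tail k)
      (fun a ha => hG.not_reach ha) h0 h1 h (.single h) hlast)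
  rcases hl.1 0 x C h0 h1 with h | h | h | h
  · exact fwd (.inl h)
  · exact hl.not_mem_of_dir hG.1 h0 h1 h h
  · exact fwd (.inr h)
  · exact fwd (.inr (hu _ _ h))

/-- A node is separated by its parents, its neighbors and the parents of its neighbors from
every nonadjacent node in its connectivity component. -/
theorem IsChainGraph.separ_of_reach {V : Type} {dir und : V → V → Prop}
    (hG : IsChainGraph dir und) {A B : V} (hAB : A ≠ B) (hr : Reach dir und B A) :
    Separ dir und {A} {B} {v | dir v A ∨ und v A ∨ ∃ w, und w A ∧ dir v w} := by
  have hu := hG.1.1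
  set S : Set V := {v | dir v A ∨ und v A ∨ ∃ w, und w A ∧ dir v w}
  have hSA : ∀ v ∈ S, Reach dir und v A := by
    rintro v (h | h | ⟨w, h, k⟩)
    · exact .single (.inl h)
    · exact .single (.inr h)
    · exact (Relation.ReflTransGen.single (.inr h)).head (.inl k)
  rintro ⟨l, x, y, rfl, rfl, hhead, hlast, hl⟩
  have h0 : l[0]? = some x := by rw [← List.head?_eq_getElem?, hhead]
  have hlen : 1 < l.length := by
    by_contra h
    rw [List.getLast?_eq_getElem?, show l.length - 1 = 0 by omega, h0] at hlast
    exact hAB (Option.some.inj hlast)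
  obtain ⟨C, h1⟩ : ∃ C, l[1]? = some C := ⟨_, List.getElem?_eq_getElem hlen⟩
  have nbr_case (h : und x C) : False := by
    have hCS : C ∈ S := .inr (.inl (hu _ _ h))
    obtain ⟨D, h2⟩ := hl.exists_next h1 hCS
    have hDC : dir D C := by
      rcases (hl.2.1 0 x C D h0 h1 h2).2 hCS with k | k | k
      · exact k.2
      · exact absurd h (hG.1.2.2.2.2 _ _ k.1).1
      · exact k.2
    exact hl.not_mem_of_dir hG.1 h1 h2 hDC (.inr (.inr ⟨C, hu _ _ h, hDC⟩))
  rcases hl.1 0 x C h0 h1 with h | h | h | h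
  · exact hG.not_reach h ((hl.getLast_of_forward hu (P := Reach dir und C)
      (fun _ _ h k => h.tail k) (fun a ha k => hG.not_reach h (k.trans (hSA a ha)))
      h0 h1 (.inl h) .refl hlast).trans hr)
  · exact hl.not_mem_of_dir hG.1 h0 h1 h (.inl h)
  · exact nbr_case h
  · exact nbr_case (hu _ _ h)

theorem stmt_7 {V : Type} [Fintype V] (dir und : V → V → Prop)
    (hG : IsChainGraph dir und) (A B : V) (hAB : A ≠ B) :
    Adj dir und A B ↔
      ¬ ∃ S : Set V, S ⊆ ({A, B} : Set V)ᶜ ∧ Separ dir und {A} {B} S := by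
  have hu := hG.1.1
  constructor
  · rintro h ⟨S, hS, hsep⟩
    have hA : A ∉ S := fun k => hS k (by simp)
    have hB : B ∉ S := fun k => hS k (by simp)
    refine hsep ⟨[A, B], A, B, rfl, rfl, rfl, rfl, ?_, ?_, ?_, ?_⟩
    · rintro (_ | i) a b ha hb
      · simp_all
      · simp at hb
    · intro i a b c _ _ hc
      simp at hc
    · simpa using hA
    · simpa using hB
  · intro h
    by_contra hadj
    apply h
    have hd1 : ¬ dir A B := fun k => hadj (.inl k)
    have hd2 : ¬ dir B A := fun k => hadj (.inr (.inl k))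
    have hu2 : ¬ und B A := fun k => hadj (.inr (.inr (.inr k)))
    have hirr : ∀ a, ¬ dir a a := fun a k => hG.1.2.1 a a k rfl
    by_cases hr : Reach dir und A B
    · by_cases hr' : Reach dir und B A
      · refine ⟨_, ?_, hG.separ_of_reach hAB hr'⟩
        rintro v hv (rfl | rfl)
        · rcases hv with k | k | ⟨w, k, k'⟩
          · exact hirr _ k
          · exact hG.1.2.2.1 _ _ k rfl
          · exact (hG.1.2.2.2.2 _ _ k').2 k
        · rcases hv with k | k | ⟨w, k, k'⟩
          · exact hd2 k
          · exact hu2 k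
          · exact hG.not_reach k' (hr.head (.inr k))
      · refine ⟨_, ?_, (hG.separ_of_not_reach hAB.symm hr').symm hu⟩
        rintro v hv (rfl | rfl)
        · exact hd1 hv
        · exact hirr _ hv
    · refine ⟨_, ?_, hG.separ_of_not_reach hAB hr⟩
      rintro v hv (rfl | rfl)
      · exact hirr _ hv
      · exact hd2 hv
end

section
/- Let H' be the hybrid graph obtained from the closed blocked graph H by directing every edge with exactly one blocked end from its blocked end toward its unblocked end and making every other edge undirected. Then G and H' have the same triplexes; moreover, every immorality of G is an immorality of H'. -/
/-- The least set of blocks over the skeleton of the graph closed under the rules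
R1-R4. `Blocked dir und S a b` means that the `a`-end of the edge `a - b` is blocked.
`S A B` is the fixed separator found for the nonadjacent pair `{A, B}`. -/
inductive Blocked (dir und : V → V → Prop) (S : V → V → Set V) : V → V → Prop where
  /-- R1 blocks the `A`-end of the edge `A - B`. -/
  | R1a (A B C : V) : Adj dir und A B → Adj dir und B C → A ≠ C → ¬ Adj dir und A C →
      B ∉ S A C → Blocked dir und S A B
  /-- R1 blocks the `C`-end of the edge `B - C`. -/
  | R1b (A B C : V) : Adj dir und A B → Adj dir und B C → A ≠ C → ¬ Adj dir und A C →
      B ∉ S A C → Blocked dir und S C B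
  | R2 (A B C : V) : Blocked dir und S A B → Adj dir und B C → A ≠ C → ¬ Adj dir und A C →
      B ∈ S A C → Blocked dir und S B C
  | R3 (A B : V) (l : List V) : l.head? = some A → l.getLast? = some B → 2 ≤ l.length →
      (∀ (i : ℕ) (a b : V), l[i]? = some a → l[i + 1]? = some b → Adj dir und a b) →
      (∀ (i : ℕ) (a b : V), l[i]? = some a → l[i + 1]? = some b → Blocked dir und S a b) →
      Adj dir und A B → Blocked dir und S A B
  | R4 (A B C D : V) : Adj dir und A B → Adj dir und A C → Adj dir und A D →
      Adj dir und C B → Adj dir und D B → Blocked dir und S C B → Blocked dir und S D B →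
      C ≠ D → ¬ Adj dir und C D → A ∈ S C D → B ∉ S C D → Blocked dir und S A B

/-- The directed edges of the hybrid graph `H'` obtained from the closed blocked graph:
an edge whose `a`-end is blocked and whose `b`-end is unblocked is directed as `a → b`. -/
def blkDir (dir und : V → V → Prop) (S : V → V → Set V) (a b : V) : Prop :=
  Adj dir und a b ∧ Blocked dir und S a b ∧ ¬ Blocked dir und S b a

/-- The undirected edges of the hybrid graph `H'` obtained from the closed blocked graph:
an edge with both ends blocked or both ends unblocked is undirected. -/
def blkUnd (dir und : V → V → Prop) (S : V → V → Set V) (a b : V) : Prop :=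
  Adj dir und a b ∧ (Blocked dir und S a b ↔ Blocked dir und S b a)

/-- A common neighbor of two separated nodes is head-no-tail between them exactly when it lies
outside the separator. -/
theorem headNoTail_iff_not_mem_separator {V : Type} {dir und : V → V → Prop} {A B C : V}
    {Z : Set V} (hZ : Z ⊆ ({A, C} : Set V)ᶜ) (hsep : Separ dir und {A} {C} Z)
    (hAB : Adj dir und A B) (hBC : Adj dir und B C) :
    HeadNoTail dir und A B C ↔ B ∉ Z := by
  have hA : A ∉ Z := fun h => hZ h (by simp)
  have hC : C ∉ Z := fun h => hZ h (by simp)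
  by_contra hne
  have hopen : HeadNoTail dir und A B C ↔ B ∈ Z := by
    by_cases hB : B ∈ Z <;> simp_all
  refine hsep ⟨[A, B, C], A, C, rfl, rfl, rfl, rfl, ?_, ?_, ?_, ?_⟩
  · rintro (_ | _ | _ | i) a b ha hb <;> simp at ha hb
    · exact ha ▸ hb ▸ hAB
    · exact ha ▸ hb ▸ hBC
  · rintro (_ | _ | i) a b c ha hb hc <;> simp at ha hb hc
    exact ha ▸ hb ▸ hc ▸ hopen
  · rintro a ha
    simp at ha
    exact ha ▸ hA
  · rintro a ha
    simp at ha
    exact ha ▸ hC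

/-- In a chain graph, a descending route cannot be closed by a directed edge. -/
theorem not_dir_of_descending {V : Type} {dir und : V → V → Prop} (hG : IsChainGraph dir und)
    {A B : V} {l : List V} (hA : l.head? = some A) (hB : l.getLast? = some B)
    (hl : ChainRel (fun a b => dir a b ∨ und a b) l) : ¬ dir B A := by
  intro hBA
  obtain _ | ⟨x, t⟩ := l
  · simp at hA
  obtain rfl : x = A := by simpa using hA
  refine hG.2 (B :: x :: t) ⟨by simp, ?_, ?_, 0, B, x, rfl, rfl, hBA⟩
  · rw [List.getLast?_cons_cons, hB]; rfl
  · rintro (_ | i) a b ha hb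
    · simp at ha hb
      exact .inl (ha ▸ hb ▸ hBA)
    · exact hl i a b (by simpa using ha) (by simpa using hb)

theorem dir_or_und_of_adj {V : Type} {dir und : V → V → Prop} (hG : IsChainGraph dir und)
    {a b : V} (h : Adj dir und a b) (hba : ¬ dir b a) : dir a b ∨ und a b := by
  have := hG.1.1 b a
  unfold Adj at h; tauto

/-- In a chain graph, a transitive step `c → b → a` or `c − b → a` between adjacent `a` and `c`
forces `c → a`. -/
theorem dir_of_adj_of_dir {V : Type} {dir und : V → V → Prop} (hG : IsChainGraph dir und)
    {a b c : V} (hcb : dir c b ∨ und c b) (hba : dir b a) (hac : Adj dir und a c) : dir c a := by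
  by_contra hca
  have hac' := dir_or_und_of_adj hG hac hca
  refine not_dir_of_descending hG (l := [a, c, b]) rfl rfl ?_ hba
  rintro (_ | _ | _ | i) x y hx hy <;> simp at hx hy
  · exact hx ▸ hy ▸ hac'
  · exact hx ▸ hy ▸ hcb

/-- A blocked end of an edge carries no arrowhead in the chain graph. -/
theorem Blocked.adj_and_not_dir {V : Type} {dir und : V → V → Prop}
    (hG : IsChainGraph dir und) {S : V → V → Set V}
    (hS : ∀ A B C : V, A ≠ C → ¬ Adj dir und A C → Adj dir und A B → Adj dir und B C →
      (HeadNoTail dir und A B C ↔ B ∉ S A C))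
    {a b : V} (h : Blocked dir und S a b) : Adj dir und a b ∧ ¬ dir b a := by
  have hasymm := hG.1.2.2.2.1
  have hdisj := hG.1.2.2.2.2
  induction h with
  | R1a A B C hAB hBC hne hnadj hmem =>
    refine ⟨hAB, fun hBA => ?_⟩
    rcases (hS A B C hne hnadj hAB hBC).2 hmem with h | h | h
    · exact hasymm _ _ hBA h.1
    · exact hasymm _ _ hBA h.1
    · exact (hdisj _ _ hBA).2 h.1
  | R1b A B C hAB hBC hne hnadj hmem =>
    refine ⟨hBC.symm, fun hBC' => ?_⟩
    rcases (hS A B C hne hnadj hAB hBC).2 hmem with h | h | h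
    · exact hasymm _ _ hBC' h.2
    · exact (hdisj _ _ hBC').1 h.2
    · exact hasymm _ _ hBC' h.2
  | R2 A B C _ hBC hne hnadj hmem ih =>
    refine ⟨hBC, fun hCB => (hS A B C hne hnadj ih.1 hBC).1 ?_ hmem⟩
    rcases dir_or_und_of_adj hG ih.1 ih.2 with h | h
    · exact .inl ⟨h, hCB⟩
    · exact .inr (.inr ⟨h, hCB⟩)
  | R3 A B l hA hB _ _ _ hAB ih =>
    exact ⟨hAB, not_dir_of_descending hG hA hB fun i a b ha hb =>
      dir_or_und_of_adj hG (ih i a b ha hb).1 (ih i a b ha hb).2⟩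
  | R4 A B C D hAB hAC hAD _ _ _ _ hne hnadj hmem _ ihC ihD =>
    refine ⟨hAB, fun hBA => (hS C A D hne hnadj hAC.symm hAD).1 (.inl ⟨?_, ?_⟩) hmem⟩
    · exact dir_of_adj_of_dir hG (dir_or_und_of_adj hG ihC.1 ihC.2) hBA hAC
    · exact dir_of_adj_of_dir hG (dir_or_und_of_adj hG ihD.1 ihD.2) hBA hAD

theorem adj_blkDir_blkUnd_iff {V : Type} {dir und : V → V → Prop} {S : V → V → Set V} {a b : V} :
    Adj (blkDir dir und S) (blkUnd dir und S) a b ↔ Adj dir und a b := by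
  have : Adj dir und a b ↔ Adj dir und b a := ⟨Adj.symm, Adj.symm⟩
  rw [Adj, blkDir, blkDir, blkUnd, blkUnd, ← this]
  by_cases h1 : Blocked dir und S a b <;> by_cases h2 : Blocked dir und S b a <;> simp [h1, h2]

theorem stmt_15 {V : Type} [Fintype V] (dir und : V → V → Prop)
    (hG : IsChainGraph dir und) (S : V → V → Set V)
    (hSsymm : ∀ A B : V, S A B = S B A)
    (hSsep : ∀ A B : V, A ≠ B → ¬ Adj dir und A B →
      S A B ⊆ ({A, B} : Set V)ᶜ ∧ Separ dir und {A} {B} (S A B)) :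
    (∀ A B C : V,
      Triplex (blkDir dir und S) (blkUnd dir und S) A B C ↔ Triplex dir und A B C) ∧
    (∀ A B C : V,
      Immorality dir und A B C → Immorality (blkDir dir und S) (blkUnd dir und S) A B C) := by
  have hS : ∀ A B C : V, A ≠ C → ¬ Adj dir und A C → Adj dir und A B → Adj dir und B C →
      (HeadNoTail dir und A B C ↔ B ∉ S A C) := fun A B C hne hnadj =>
    headNoTail_iff_not_mem_separator (hSsep A C hne hnadj).1 (hSsep A C hne hnadj).2
  have hblk : ∀ a b : V, dir a b → ¬ Blocked dir und S b a := fun a b hab h =>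
    (h.adj_and_not_dir hG hS).2 hab
  have hends : ∀ A B C : V, Triplex dir und A B C → Adj dir und A B ∧ Adj dir und B C ∧
      Blocked dir und S A B ∧ Blocked dir und S C B := by
    rintro A B C ⟨hne, hnadj, h⟩
    have hAB : Adj dir und A B := by unfold Adj; tauto
    have hBC : Adj dir und B C := by unfold Adj; tauto
    have hmem := (hS A B C hne hnadj hAB hBC).1 h
    exact ⟨hAB, hBC, .R1a A B C hAB hBC hne hnadj hmem, .R1b A B C hAB hBC hne hnadj hmem⟩
  refine ⟨fun A B C => ⟨?_, ?_⟩, ?_⟩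
  · rintro ⟨hne, hnadj, h⟩
    rw [adj_blkDir_blkUnd_iff] at hnadj
    have hAB : Adj dir und A B := by
      rcases h with h | h | h <;> exact h.1.1
    have hBC : Adj dir und B C := by
      rcases h with h | h | h
      exacts [h.2.1.symm, h.2.1, h.2.1.symm]
    refine ⟨hne, hnadj, (hS A B C hne hnadj hAB hBC).2 fun hmem => ?_⟩
    have hAC : Blocked dir und S A B → Blocked dir und S B C := fun hb =>
      .R2 A B C hb hBC hne hnadj hmem
    have hCA : Blocked dir und S C B → Blocked dir und S B A := fun hb =>
      .R2 C B A hb hAB.symm hne.symm (fun h => hnadj h.symm) (hSsymm A C ▸ hmem)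
    unfold blkDir blkUnd at h
    tauto
  · intro h
    obtain ⟨hAB, hBC, hA, hC⟩ := hends A B C h
    obtain ⟨hne, hnadj, h⟩ := h
    refine ⟨hne, mt adj_blkDir_blkUnd_iff.1 hnadj, ?_⟩
    have hCB := hBC.symm
    have hA' := hblk A B
    have hC' := hblk C B
    unfold blkDir blkUnd
    tauto
  · rintro A B C ⟨hne, hnadj, hdAB, hdCB⟩
    obtain ⟨hAB, hBC, hA, hC⟩ := hends A B C ⟨hne, hnadj, .inl ⟨hdAB, hdCB⟩⟩
    exact ⟨hne, mt adj_blkDir_blkUnd_iff.1 hnadj, ⟨hAB, hA, hblk A B hdAB⟩,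
      ⟨hBC.symm, hC, hblk C B hdCB⟩⟩
end
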